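/- Let β, γ > 0, D ≥ 1, let (X,d,m) be a metric measure space, and fix x0 ∈ X. Assume: (i) there exists a constant C > 0, independent of k, such that for every k ∈ ℕ and every Lipschitz function u : X → ℝ with bounded support, (∫_X d(x0,x)^{2k} (lip u(x))² dm)(∫_X d(x0,x)^{2k+2} u(x)² dm) ≥ (C+k)² (∫_X d(x0,x)^{2k} u(x)² dm)²; (ii) m(B_R(x))/R^γ ≤ D · m(B_r(x))/r^γ for all 0 < r < R and all x ∈ X; (iii) liminf_{r→0⁺} m(B_r(x0))/r^β = c* for some c* ∈ (0,∞). Then there exists a constant C* > 0 such that for all r > 0 and all x ∈ X, m(B_r(x))/r^β ≥ C* · (1 + r + d(x0,x))^{−(β−2C)} · (1 + d(x0,x)/r)^{−(γ−β)}. -/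

import Mathlib

open MeasureTheory Filter Metric
open scoped ENNReal Topology NNReal

/-- The local Lipschitz constant `lip u (x) = limsup_{y → x} |u y - u x| / d(y,x)`. -/
noncomputable def lip {X : Type*} [MetricSpace X] (u : X → ℝ) (x : X) : ℝ :=
  Filter.limsup (fun y => |u y - u x| / dist y x) (𝓝[≠] x)

section Gaussian

variable {X : Type*} [MetricSpace X]

theorem nonneg_of_eventually_slope_le {u : X → ℝ} {x : X} [(𝓝[≠] x).NeBot] {a : ℝ}
    (h : ∀ᶠ y in 𝓝[≠] x, |u y - u x| / dist y x ≤ a) : 0 ≤ a := by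
  obtain ⟨y, hy⟩ := h.exists
  exact le_trans (by positivity) hy

/-- The local Lipschitz constant is at most any eventual bound on the difference quotients. -/
theorem lip_le_of_eventually_le {u : X → ℝ} {x : X} {a : ℝ} (ha : 0 ≤ a)
    (h : ∀ᶠ y in 𝓝[≠] x, |u y - u x| / dist y x ≤ a) : lip u x ≤ a := by
  rw [lip, Filter.limsup_eq]
  rcases eq_or_neBot (𝓝[≠] x) with hbot | hne
  · simpa [hbot] using ha
  · exact csInf_le ⟨0, fun b hb => nonneg_of_eventually_slope_le hb⟩ h

theorem lip_nonneg (u : X → ℝ) (x : X) : 0 ≤ lip u x := by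
  rw [lip, Filter.limsup_eq]
  rcases eq_or_neBot (𝓝[≠] x) with hbot | hne
  · simp [hbot]
  · exact Real.sInf_nonneg fun b hb => nonneg_of_eventually_slope_le hb

theorem hasDerivAt_gaussian (t s : ℝ) :
    HasDerivAt (fun s : ℝ => Real.exp (-(t / 2 * s ^ 2))) (-(t * s * Real.exp (-(t / 2 * s ^ 2)))) s := by
  have h := (((hasDerivAt_pow 2 s).const_mul (t / 2)).fun_neg).exp
  refine h.congr_deriv ?_
  push_cast
  ring

/-- The Gaussian of the distance to `x0`, lowered by `ε` and truncated at zero. -/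
noncomputable def truncatedGaussian (x0 : X) (t ε : ℝ) (x : X) : ℝ :=
  max (Real.exp (-(t / 2 * dist x0 x ^ 2)) - ε) 0

theorem abs_truncatedGaussian_sub_le (x0 : X) (t ε : ℝ) (x y : X) :
    |truncatedGaussian x0 t ε y - truncatedGaussian x0 t ε x| ≤
      |Real.exp (-(t / 2 * dist x0 y ^ 2)) - Real.exp (-(t / 2 * dist x0 x ^ 2))| := by
  refine (abs_max_sub_max_le_abs _ _ _).trans_eq ?_
  congr 1
  ring

theorem lipschitzWith_gaussian {t : ℝ} (ht : 0 < t) :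
    LipschitzWith (1 + t).toNNReal (fun s : ℝ => Real.exp (-(t / 2 * s ^ 2))) := by
  refine lipschitzWith_of_nnnorm_deriv_le (fun s => (hasDerivAt_gaussian t s).differentiableAt) ?_
  intro s
  rw [← NNReal.coe_le_coe, Real.coe_toNNReal _ (by positivity), coe_nnnorm,
    (hasDerivAt_gaussian t s).deriv, norm_neg, Real.norm_eq_abs, abs_mul, Real.abs_exp,
    Real.exp_neg, ← div_eq_mul_inv, div_le_iff₀ (Real.exp_pos _), abs_mul, abs_of_pos ht]
  have h1 := Real.add_one_le_exp (t / 2 * s ^ 2)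
  have h2 : |s| ^ 2 = s ^ 2 := sq_abs s
  have h3 : t * |s| ≤ (1 + t) * (t / 2 * s ^ 2 + 1) := by
    rw [← h2]
    nlinarith [mul_nonneg ht.le (sq_nonneg (|s| - 1)), mul_nonneg (mul_nonneg ht.le ht.le) (sq_nonneg s),
      mul_nonneg (mul_nonneg ht.le ht.le) (sq_nonneg |s|)]
  exact h3.trans (by gcongr)

theorem lipschitzWith_truncatedGaussian (x0 : X) {t : ℝ} (ht : 0 < t) (ε : ℝ) :
    LipschitzWith (1 + t).toNNReal (truncatedGaussian x0 t ε) := by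
  refine LipschitzWith.of_dist_le_mul fun x y => ?_
  rw [Real.dist_eq]
  refine (abs_truncatedGaussian_sub_le x0 t ε y x).trans ?_
  rw [← Real.dist_eq]
  refine ((lipschitzWith_gaussian ht).dist_le_mul _ _).trans ?_
  gcongr
  simpa using (LipschitzWith.dist_right x0).dist_le_mul x y

theorem lip_truncatedGaussian_le (x0 : X) {t : ℝ} (ht : 0 < t) (ε : ℝ) (x : X) :
    lip (truncatedGaussian x0 t ε) x ≤ t * dist x0 x * Real.exp (-(t / 2 * dist x0 x ^ 2)) := by
  refine le_of_forall_pos_le_add fun η hη => ?_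
  refine lip_le_of_eventually_le (by positivity) ?_
  have h := (hasDerivAt_iff_isLittleO.1 (hasDerivAt_gaussian t (dist x0 x))).def hη
  have hc : Tendsto (fun y => dist x0 y) (𝓝[≠] x) (𝓝 (dist x0 x)) :=
    ((continuous_const.dist continuous_id).tendsto x).mono_left nhdsWithin_le_nhds
  filter_upwards [hc.eventually h, self_mem_nhdsWithin] with y hy hyx
  rw [div_le_iff₀ (dist_pos.2 hyx)]
  refine (abs_truncatedGaussian_sub_le x0 t ε x y).trans ?_
  have hd : |dist x0 y - dist x0 x| ≤ dist y x := by
    simpa [Real.dist_eq] using (LipschitzWith.dist_right x0).dist_le_mul y x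
  set a := t * dist x0 x * Real.exp (-(t / 2 * dist x0 x ^ 2)) with ha
  have ha0 : 0 ≤ a := by positivity
  simp only [Real.norm_eq_abs, smul_eq_mul] at hy
  have h1 := abs_le.1 hy
  set p := dist x0 y - dist x0 x
  have h2 : |p * a| ≤ |p| * a := by rw [abs_mul, abs_of_nonneg ha0]
  have h3 := abs_le.1 h2
  have h4 : (a + η) * |p| ≤ (a + η) * dist y x := by gcongr
  rw [abs_le]
  constructor <;> nlinarith

theorem isBounded_support_truncatedGaussian (x0 : X) {t ε : ℝ} (ht : 0 < t) (hε : 0 < ε) :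
    Bornology.IsBounded (Function.support (truncatedGaussian x0 t ε)) := by
  refine (Metric.isBounded_closedBall (x := x0) (r := 2 / (t * ε) + 1)).subset fun x hx => ?_
  have h1 : ε < Real.exp (-(t / 2 * dist x0 x ^ 2)) := by
    by_contra! h
    exact hx (max_eq_right (by linarith))
  rw [mem_closedBall, dist_comm]
  by_contra! h
  set d := dist x0 x
  have h5 : 0 < 2 / (t * ε) := by positivity
  have h2 : 2 / (t * ε) < d ^ 2 := by nlinarith
  rw [div_lt_iff₀ (by positivity)] at h2
  rw [Real.exp_neg] at h1
  have h3 := Real.add_one_le_exp (t / 2 * d ^ 2)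
  have h4 : ε * Real.exp (t / 2 * d ^ 2) < 1 := by
    have := mul_lt_mul_of_pos_right h1 (Real.exp_pos (t / 2 * d ^ 2))
    rwa [inv_mul_cancel₀ (Real.exp_pos _).ne'] at this
  nlinarith

end Gaussian

section Integrals

variable {X : Type*} [MetricSpace X] [MeasurableSpace X] [BorelSpace X]

theorem summable_exp_neg_sq_mul_rpow (γ : ℝ) :
    Summable fun n : ℕ => Real.exp (-(n : ℝ) ^ 2) * ((n : ℝ) + 1) ^ γ := by
  obtain ⟨N, hN⟩ := exists_nat_ge γ
  have h := (Real.summable_pow_mul_exp_neg_nat_mul N (r := 1) one_pos)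
  have h' := ((summable_nat_add_iff 1).2 h).mul_left (Real.exp 2)
  refine Summable.of_nonneg_of_le (fun n => by positivity) (fun n => ?_) h'
  push_cast
  have h1 : ((n : ℝ) + 1) ^ γ ≤ ((n : ℝ) + 1) ^ N := by
    rw [← Real.rpow_natCast]
    exact Real.rpow_le_rpow_of_exponent_le (by linarith [Nat.cast_nonneg (α := ℝ) n]) hN
  have h2 : Real.exp (-(n : ℝ) ^ 2) ≤ Real.exp 2 * Real.exp (-1 * ((n : ℝ) + 1)) := by
    rw [← Real.exp_add]
    refine Real.exp_le_exp.2 ?_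
    nlinarith [sq_nonneg ((n : ℝ) - 1)]
  calc _ ≤ (Real.exp 2 * Real.exp (-1 * ((n : ℝ) + 1))) * ((n : ℝ) + 1) ^ N := by gcongr
    _ = _ := by ring

/-- Under polynomial volume growth, a Gaussian at scale `r` has mass comparable to at most
that of the ball of radius `r`. -/
theorem lintegral_gaussian_le {m : Measure X} {x0 : X} {γ D : ℝ} (hD : 1 ≤ D)
    (hfin : ∀ r, m (ball x0 r) ≠ ⊤)
    (hVD : ∀ r R : ℝ, 0 < r → r < R →
      (m (ball x0 R)).toReal / R ^ γ ≤ D * ((m (ball x0 r)).toReal / r ^ γ))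
    {r : ℝ} (hr : 0 < r) :
    ∫⁻ x, ENNReal.ofReal (Real.exp (-(dist x0 x / r) ^ 2)) ∂m ≤
      ENNReal.ofReal ((∑' n : ℕ, Real.exp (-(n : ℝ) ^ 2) * ((n : ℝ) + 1) ^ γ) * D *
        (m (ball x0 r)).toReal) := by
  have hball : ∀ n : ℕ, (m (ball x0 ((n + 1) * r))).toReal ≤
      ((n : ℝ) + 1) ^ γ * D * (m (ball x0 r)).toReal := by
    intro n
    rcases Nat.eq_zero_or_pos n with rfl | hn
    · simpa using le_mul_of_one_le_left ENNReal.toReal_nonneg hD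
    · have hn' : (0 : ℝ) < n := by exact_mod_cast hn
      have h := hVD r ((n + 1) * r) hr (by nlinarith)
      rw [Real.mul_rpow (by positivity) hr.le, div_le_iff₀ (by positivity)] at h
      refine h.trans_eq ?_
      have : r ^ γ ≠ 0 := by positivity
      field_simp
  have hpt : ∀ x, ENNReal.ofReal (Real.exp (-(dist x0 x / r) ^ 2)) ≤
      ∑' n : ℕ, (ball x0 (((n : ℝ) + 1) * r)).indicator
        (fun _ => ENNReal.ofReal (Real.exp (-(n : ℝ) ^ 2))) x := by
    intro x
    set n := ⌊dist x0 x / r⌋₊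
    refine le_trans ?_ (ENNReal.le_tsum n)
    have h1 : (n : ℝ) ≤ dist x0 x / r := Nat.floor_le (by positivity)
    have h2 : dist x0 x / r < n + 1 := Nat.lt_floor_add_one _
    rw [Set.indicator_of_mem]
    · gcongr
    · rw [mem_ball, dist_comm]
      exact (div_lt_iff₀ hr).1 h2
  refine (lintegral_mono hpt).trans ?_
  rw [lintegral_tsum fun n => (measurable_const.indicator measurableSet_ball).aemeasurable,
    mul_assoc, ← tsum_mul_right,
    ENNReal.ofReal_tsum_of_nonneg (fun n => by positivity)
      ((summable_exp_neg_sq_mul_rpow γ).mul_right _)]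
  refine ENNReal.tsum_le_tsum fun n => ?_
  rw [lintegral_indicator_const measurableSet_ball, ← ENNReal.ofReal_toReal (hfin _),
    ← ENNReal.ofReal_mul (Real.exp_pos _).le, mul_assoc]
  refine ENNReal.ofReal_le_ofReal ?_
  gcongr
  rw [← mul_assoc]
  exact hball n

variable {m : Measure X} {x0 : X}

theorem integrable_sq_mul_gaussian
    (hint : ∀ t : ℝ, 0 < t → Integrable (fun x => Real.exp (-(t * dist x0 x ^ 2))) m)
    {t : ℝ} (ht : 0 < t) :
    Integrable (fun x => dist x0 x ^ 2 * Real.exp (-(t * dist x0 x ^ 2))) m := by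
  refine ((hint (t / 2) (by positivity)).const_mul (2 / t)).mono'
    (by fun_prop) (ae_of_all _ fun x => ?_)
  rw [Real.norm_of_nonneg (by positivity)]
  set y := dist x0 x ^ 2
  have h1 : y ≤ 2 / t * Real.exp (t / 2 * y) := by
    have := Real.add_one_le_exp (t / 2 * y)
    rw [div_mul_eq_mul_div, le_div_iff₀ ht]
    nlinarith
  calc y * Real.exp (-(t * y)) ≤ 2 / t * Real.exp (t / 2 * y) * Real.exp (-(t * y)) := by gcongr
    _ = 2 / t * Real.exp (-(t / 2 * y)) := by
      rw [mul_assoc, ← Real.exp_add]; ring_nf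

theorem hasDerivAt_integral_gaussian
    (hint : ∀ t : ℝ, 0 < t → Integrable (fun x => Real.exp (-(t * dist x0 x ^ 2))) m)
    {t : ℝ} (ht : 0 < t) :
    HasDerivAt (fun t => ∫ x, Real.exp (-(t * dist x0 x ^ 2)) ∂m)
      (∫ x, -(dist x0 x ^ 2 * Real.exp (-(t * dist x0 x ^ 2))) ∂m) t := by
  refine (hasDerivAt_integral_of_dominated_loc_of_deriv_le (s := Set.Ioi (t / 2))
    (F' := fun t x => -(dist x0 x ^ 2 * Real.exp (-(t * dist x0 x ^ 2))))
    (bound := fun x => dist x0 x ^ 2 * Real.exp (-(t / 2 * dist x0 x ^ 2)))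
    (Ioi_mem_nhds (by linarith)) (Eventually.of_forall fun s => by fun_prop) (hint t ht)
    (by fun_prop) (ae_of_all _ fun x s hs => ?_)
    (integrable_sq_mul_gaussian hint (by positivity)) (ae_of_all _ fun x s hs => ?_)).2
  · rw [norm_neg, Real.norm_of_nonneg (by positivity)]
    have : t / 2 ≤ s := (Set.mem_Ioi.1 hs).le
    gcongr
  · have h := (((hasDerivAt_id s).mul_const (dist x0 x ^ 2)).fun_neg).exp
    refine h.congr_deriv ?_
    simp only [id]
    ring

/-- The uncertainty inequality, tested on Gaussians. -/
theorem gaussian_uncertainty {C : ℝ} (hC : 0 < C)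
    (hHPW : ∀ u : X → ℝ, (∃ K : ℝ≥0, LipschitzWith K u) →
      Bornology.IsBounded (Function.support u) →
      C ^ 2 * (∫ x, u x ^ 2 ∂m) ^ 2 ≤
        (∫ x, lip u x ^ 2 ∂m) * ∫ x, dist x0 x ^ 2 * u x ^ 2 ∂m)
    (hint : ∀ t : ℝ, 0 < t → Integrable (fun x => Real.exp (-(t * dist x0 x ^ 2))) m)
    {t : ℝ} (ht : 0 < t) :
    C * ∫ x, Real.exp (-(t * dist x0 x ^ 2)) ∂m ≤
      t * ∫ x, dist x0 x ^ 2 * Real.exp (-(t * dist x0 x ^ 2)) ∂m := by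
  set P := ∫ x, Real.exp (-(t * dist x0 x ^ 2)) ∂m
  set Q := ∫ x, dist x0 x ^ 2 * Real.exp (-(t * dist x0 x ^ 2)) ∂m with hQ
  set H := ∫ x, Real.exp (-(t / 2 * dist x0 x ^ 2)) ∂m
  have hQ0 : 0 ≤ Q := integral_nonneg fun x => by positivity
  have hsq : ∀ x, Real.exp (-(t / 2 * dist x0 x ^ 2)) ^ 2 = Real.exp (-(t * dist x0 x ^ 2)) := by
    intro x
    rw [← Real.exp_nat_mul]
    congr 1
    push_cast
    ring
  have hiQ := integrable_sq_mul_gaussian hint ht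
  have hlow : ∀ ε > 0, C * (P - 2 * ε * H) ≤ t * Q := by
    intro ε hε
    set u := truncatedGaussian x0 t ε with hu
    have hule : ∀ x, u x ^ 2 ≤ Real.exp (-(t * dist x0 x ^ 2)) := by
      intro x
      rw [← hsq]
      have h0 : 0 ≤ u x := le_max_right _ _
      have h1 : u x ≤ Real.exp (-(t / 2 * dist x0 x ^ 2)) :=
        max_le (by linarith) (Real.exp_pos _).le
      gcongr
    have huge : ∀ x, Real.exp (-(t * dist x0 x ^ 2)) - 2 * ε * Real.exp (-(t / 2 * dist x0 x ^ 2))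
        ≤ u x ^ 2 := by
      intro x
      rw [← hsq]
      simp only [hu, truncatedGaussian]
      set g := Real.exp (-(t / 2 * dist x0 x ^ 2)) with hg
      have hg0 : 0 < g := Real.exp_pos _
      rcases le_total g ε with h | h
      · rw [max_eq_right (by linarith)]
        nlinarith
      · rw [max_eq_left (by linarith)]
        nlinarith
    have hucont : Continuous u := (lipschitzWith_truncatedGaussian x0 ht ε).continuous
    have hiu : Integrable (fun x => u x ^ 2) m := by
      refine (hint t ht).mono' (by fun_prop) (ae_of_all _ fun x => ?_)
      rw [Real.norm_of_nonneg (by positivity)]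
      exact hule x
    have hA : P - 2 * ε * H ≤ ∫ x, u x ^ 2 ∂m := by
      have hiH := (hint (t / 2) (by positivity)).const_mul (2 * ε)
      rw [← integral_const_mul, ← integral_sub (hint t ht) hiH]
      exact integral_mono ((hint t ht).sub hiH) hiu huge
    have hB : ∫ x, lip u x ^ 2 ∂m ≤ t ^ 2 * Q := by
      rw [hQ, ← integral_const_mul]
      refine integral_mono_of_nonneg (ae_of_all _ fun x => sq_nonneg _)
        (hiQ.const_mul _) (ae_of_all _ fun x => ?_)
      have h := pow_le_pow_left₀ (lip_nonneg u x) (lip_truncatedGaussian_le x0 ht ε x) 2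
      refine h.trans_eq ?_
      rw [mul_pow, hsq]
      ring
    have hE : ∫ x, dist x0 x ^ 2 * u x ^ 2 ∂m ≤ Q := by
      refine integral_mono_of_nonneg (ae_of_all _ fun x => by positivity) hiQ
        (ae_of_all _ fun x => ?_)
      exact mul_le_mul_of_nonneg_left (hule x) (sq_nonneg _)
    have hmain := hHPW u ⟨_, lipschitzWith_truncatedGaussian x0 ht ε⟩
      (isBounded_support_truncatedGaussian x0 ht hε)
    have hprod : (C * ∫ x, u x ^ 2 ∂m) ^ 2 ≤ (t * Q) ^ 2 := by
      calc _ = C ^ 2 * (∫ x, u x ^ 2 ∂m) ^ 2 := by ring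
        _ ≤ _ := hmain
        _ ≤ (t ^ 2 * Q) * Q :=
          mul_le_mul hB hE (integral_nonneg fun x => by positivity) (by positivity)
        _ = _ := by ring
    calc _ ≤ C * ∫ x, u x ^ 2 ∂m := by gcongr
      _ ≤ t * Q := (abs_le_of_sq_le_sq' hprod (by positivity)).2
  have hlim : Tendsto (fun ε : ℝ => C * (P - 2 * ε * H)) (𝓝[>] 0) (𝓝 (C * (P - 2 * 0 * H))) :=
    (Continuous.tendsto (by fun_prop) 0).mono_left nhdsWithin_le_nhds
  have := le_of_tendsto hlim (eventually_mem_nhdsWithin.mono fun ε hε => hlow ε hε)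
  simpa using this

theorem antitoneOn_rpow_mul_integral_gaussian {C : ℝ} (hC : 0 < C)
    (hHPW : ∀ u : X → ℝ, (∃ K : ℝ≥0, LipschitzWith K u) →
      Bornology.IsBounded (Function.support u) →
      C ^ 2 * (∫ x, u x ^ 2 ∂m) ^ 2 ≤
        (∫ x, lip u x ^ 2 ∂m) * ∫ x, dist x0 x ^ 2 * u x ^ 2 ∂m)
    (hint : ∀ t : ℝ, 0 < t → Integrable (fun x => Real.exp (-(t * dist x0 x ^ 2))) m) :
    AntitoneOn (fun t : ℝ => t ^ C * ∫ x, Real.exp (-(t * dist x0 x ^ 2)) ∂m) (Set.Ioi 0) := by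
  have hder : ∀ t : ℝ, 0 < t → HasDerivAt
      (fun t : ℝ => t ^ C * ∫ x, Real.exp (-(t * dist x0 x ^ 2)) ∂m)
      (C * t ^ (C - 1) * (∫ x, Real.exp (-(t * dist x0 x ^ 2)) ∂m) +
        t ^ C * ∫ x, -(dist x0 x ^ 2 * Real.exp (-(t * dist x0 x ^ 2))) ∂m) t := fun t ht =>
    (Real.hasDerivAt_rpow_const (Or.inl ht.ne')).mul (hasDerivAt_integral_gaussian hint ht)
  refine antitoneOn_of_deriv_nonpos (convex_Ioi 0)
    (fun t ht => (hder t ht).continuousAt.continuousWithinAt) ?_ ?_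
  · rw [interior_Ioi]
    exact fun t ht => (hder t ht).differentiableAt.differentiableWithinAt
  · rw [interior_Ioi]
    intro t ht
    have ht' : 0 < t := ht
    rw [(hder t ht).deriv, integral_neg]
    have h := gaussian_uncertainty hC hHPW hint ht'
    have hp : t ^ C = t ^ (C - 1) * t := by
      rw [← Real.rpow_add_one ht'.ne']
      congr 1
      ring
    rw [hp]
    have hpos : 0 < t ^ (C - 1) := by positivity
    nlinarith [mul_le_mul_of_nonneg_left h hpos.le]

end Integrals

/-- A positive lower density at `x0` propagates to all balls of radius at most one. -/
theorem exists_le_measureReal_ball_of_liminf {X : Type*} [MetricSpace X] [MeasurableSpace X]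
    {m : Measure X} {x0 : X} (hfin : ∀ r, m (ball x0 r) ≠ ⊤) {β c : ℝ} (hc : 0 < c)
    (h : Filter.liminf (fun r : ℝ => (m (ball x0 r)).toReal / r ^ β) (𝓝[>] 0) = c) :
    ∃ a > 0, ∀ s : ℝ, 0 < s → s ≤ 1 → a * s ^ β ≤ (m (ball x0 s)).toReal := by
  have hne : {a : ℝ | ∀ᶠ r in (𝓝[>] (0 : ℝ)), a ≤ (m (ball x0 r)).toReal / r ^ β}.Nonempty := by
    refine ⟨0, ?_⟩
    filter_upwards [self_mem_nhdsWithin] with r hr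
    have : (0 : ℝ) < r := hr
    positivity
  rw [Filter.liminf_eq] at h
  obtain ⟨a, ha, ha0⟩ := exists_lt_of_lt_csSup hne (h ▸ hc)
  obtain ⟨δ, hδ, hδa⟩ := (mem_nhdsGT_iff_exists_Ioo_subset).1 ha
  have hδ' : 0 < δ := hδ
  set e := min δ 1 / 2 with he
  have he0 : 0 < e := by positivity
  have he1 : e < δ := by have := min_le_left δ 1; linarith
  have he2 : e ≤ 1 := by have := min_le_right δ 1; linarith
  refine ⟨a * e ^ β, by positivity, fun s hs hs1 => ?_⟩
  have hmem : a ≤ (m (ball x0 (e * s))).toReal / (e * s) ^ β :=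
    hδa ⟨by positivity, by nlinarith⟩
  rw [le_div_iff₀ (by positivity), Real.mul_rpow he0.le hs.le, ← mul_assoc] at hmem
  refine hmem.trans (ENNReal.toReal_mono (hfin s) (measure_mono (ball_subset_ball ?_)))
  nlinarith

/-- Real powers of a quantity in `[1, 2]` are bounded, whatever the sign of the exponent. -/
theorem rpow_le_two_rpow_abs {y e : ℝ} (h1 : 1 ≤ y) (h2 : y ≤ 2) : y ^ e ≤ 2 ^ |e| :=
  (Real.rpow_le_rpow_of_exponent_le h1 (le_abs_self e)).trans
    (Real.rpow_le_rpow (by linarith) h2 (abs_nonneg e))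

/-- Glue a small-scale and a large-scale power lower bound. -/
theorem exists_le_of_small_of_large {V : ℝ → ℝ} {β p a b : ℝ} (ha : 0 < a) (hb : 0 < b)
    (hsmall : ∀ s : ℝ, 0 < s → s ≤ 1 → a * s ^ β ≤ V s)
    (hlarge : ∀ s : ℝ, 1 ≤ s → b * s ^ p ≤ V s) :
    ∃ c > 0, ∀ s : ℝ, 0 < s → c * s ^ β * (1 + s) ^ (p - β) ≤ V s := by
  have hpow : (0 : ℝ) < 2 ^ |p - β| := by positivity
  refine ⟨min a b / 2 ^ |p - β|, by positivity, fun s hs => ?_⟩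
  rcases le_total s 1 with h | h
  · refine le_trans ?_ (hsmall s hs h)
    have h1 : (1 + s) ^ (p - β) ≤ 2 ^ |p - β| := rpow_le_two_rpow_abs (by linarith) (by linarith)
    calc _ ≤ min a b / 2 ^ |p - β| * s ^ β * 2 ^ |p - β| := by gcongr
      _ = min a b * s ^ β := by field_simp
      _ ≤ a * s ^ β := by gcongr; exact min_le_left _ _
  · refine le_trans ?_ (hlarge s h)
    have h1 : ((1 + s) / s) ^ (p - β) ≤ 2 ^ |p - β| := by
      refine rpow_le_two_rpow_abs ?_ ?_
      · rw [le_div_iff₀ hs]; linarith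
      · rw [div_le_iff₀ hs]; linarith
    rw [Real.div_rpow (by positivity) hs.le, div_le_iff₀ (by positivity)] at h1
    calc _ ≤ min a b / 2 ^ |p - β| * s ^ β * (2 ^ |p - β| * s ^ (p - β)) := by gcongr
      _ = min a b * (s ^ β * s ^ (p - β)) := by field_simp
      _ = min a b * s ^ p := by rw [← Real.rpow_add hs]; congr 2; ring
      _ ≤ b * s ^ p := by gcongr; exact min_le_right _ _

theorem stmt_3 {X : Type*} [MetricSpace X] [CompleteSpace X]
    [TopologicalSpace.SeparableSpace X] [MeasurableSpace X] [BorelSpace X]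
    (m : Measure X)
    (hm : ∀ U : Set X, IsOpen U → U.Nonempty → Bornology.IsBounded U → 0 < m U ∧ m U < ⊤)
    (x0 : X) (β γ D : ℝ) (hβ : 0 < β) (hγ : 0 < γ) (hD : 1 ≤ D)
    (C : ℝ) (hC : 0 < C)
    (hCKN : ∀ (k : ℕ) (u : X → ℝ), (∃ K : ℝ≥0, LipschitzWith K u) →
      Bornology.IsBounded (Function.support u) →
      (∫ x, dist x0 x ^ (2 * k) * (lip u x) ^ 2 ∂m) *
        (∫ x, dist x0 x ^ (2 * k + 2) * (u x) ^ 2 ∂m) ≥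
      (C + k) ^ 2 * (∫ x, dist x0 x ^ (2 * k) * (u x) ^ 2 ∂m) ^ 2)
    (hVD : ∀ (x : X) (r R : ℝ), 0 < r → r < R →
      (m (ball x R)).toReal / R ^ γ ≤ D * ((m (ball x r)).toReal / r ^ γ))
    (cstar : ℝ) (hcstar : 0 < cstar)
    (hAR : Filter.liminf (fun r : ℝ => (m (ball x0 r)).toReal / r ^ β) (𝓝[>] 0) = cstar) :
    ∃ Cstar : ℝ, 0 < Cstar ∧ ∀ (r : ℝ) (x : X), 0 < r →
      (m (ball x r)).toReal / r ^ β ≥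
        Cstar * (1 + r + dist x0 x) ^ (-(β - 2 * C)) * (1 + dist x0 x / r) ^ (-(γ - β)) := by
  have hfin : ∀ (x : X) (r : ℝ), m (ball x r) ≠ ⊤ := by
    intro x r
    rcases le_or_gt r 0 with h | h
    · simp [ball_eq_empty.2 h]
    · exact (hm _ isOpen_ball ⟨x, mem_ball_self h⟩ isBounded_ball).2.ne
  have hgauss := fun {r : ℝ} (hr : 0 < r) => lintegral_gaussian_le hD (hfin x0) (hVD x0) hr
  set S := ∑' n : ℕ, Real.exp (-(n : ℝ) ^ 2) * ((n : ℝ) + 1) ^ γ with hS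
  have hSpos : 0 < S :=
    (summable_exp_neg_sq_mul_rpow γ).tsum_pos (fun n => by positivity) 0 (by positivity)
  have hscale : ∀ r : ℝ, 0 < r → ∀ x, Real.exp (-((r ^ 2)⁻¹ * dist x0 x ^ 2)) =
      Real.exp (-(dist x0 x / r) ^ 2) := by
    intro r hr x
    congr 1
    field_simp
  have hint : ∀ t : ℝ, 0 < t → Integrable (fun x => Real.exp (-(t * dist x0 x ^ 2))) m := by
    intro t ht
    refine ⟨by fun_prop, ?_⟩
    rw [hasFiniteIntegral_iff_ofReal (ae_of_all _ fun x => (Real.exp_pos _).le)]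
    have hsqrt : 0 < (√t)⁻¹ := by positivity
    have ht' : t = (((√t)⁻¹) ^ 2)⁻¹ := by
      rw [inv_pow, inv_inv, Real.sq_sqrt ht.le]
    rw [ht']
    simp_rw [hscale _ hsqrt]
    exact (hgauss hsqrt).trans_lt ENNReal.ofReal_lt_top
  have hanti := antitoneOn_rpow_mul_integral_gaussian (m := m) (x0 := x0) hC
    (fun u hu hb => by simpa using hCKN 0 u hu hb) hint
  have hne : NeZero m := by
    refine ⟨fun h => ?_⟩
    have := (hm (ball x0 1) isOpen_ball ⟨x0, mem_ball_self one_pos⟩ isBounded_ball).1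
    simp [h] at this
  set P₁ := ∫ x, Real.exp (-(1 * dist x0 x ^ 2)) ∂m with hP₁
  have hP₁pos : 0 < P₁ := integral_exp_pos (hint 1 one_pos)
  obtain ⟨a, ha, hsmall⟩ := exists_le_measureReal_ball_of_liminf (hfin x0) hcstar hAR
  have hlarge : ∀ s : ℝ, 1 ≤ s → P₁ / (S * D) * s ^ (2 * C) ≤ (m (ball x0 s)).toReal := by
    intro s hs
    have hs0 : 0 < s := by linarith
    have h1 := hanti (show (s ^ 2)⁻¹ ∈ Set.Ioi (0 : ℝ) from Set.mem_Ioi.2 (by positivity))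
      (show (1 : ℝ) ∈ Set.Ioi (0 : ℝ) from Set.mem_Ioi.2 one_pos)
      (inv_le_one_of_one_le₀ (one_le_pow₀ hs))
    simp only [Real.one_rpow, one_mul (M := ℝ), hscale s hs0] at h1
    have h2 : ∫ x, Real.exp (-(dist x0 x / s) ^ 2) ∂m ≤ S * D * (m (ball x0 s)).toReal := by
      rw [integral_eq_lintegral_of_nonneg_ae (ae_of_all _ fun x => (Real.exp_pos _).le)
        (by fun_prop)]
      exact ENNReal.toReal_le_of_le_ofReal (by positivity) (hgauss hs0)
    have h3 : ((s ^ 2)⁻¹) ^ C = (s ^ (2 * C))⁻¹ := by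
      rw [Real.inv_rpow (by positivity), ← Real.rpow_natCast, ← Real.rpow_mul hs0.le]
      norm_num
    rw [h3, inv_mul_eq_div, le_div_iff₀ (by positivity)] at h1
    rw [div_mul_eq_mul_div, div_le_iff₀ (by positivity)]
    simp only [hP₁, one_mul]
    linarith
  obtain ⟨c, hc, hV⟩ := exists_le_of_small_of_large ha (by positivity) hsmall hlarge
  refine ⟨c / (D * 2 ^ γ), by positivity, fun r x hr => ?_⟩
  have hd0 : 0 ≤ dist x0 x := dist_nonneg
  set s := r + dist x0 x with hs
  have hs0 : 0 < s := by positivity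
  have hsub : (m (ball x0 s)).toReal ≤ (m (ball x (2 * s))).toReal := by
    refine ENNReal.toReal_mono (hfin _ _) (measure_mono (ball_subset_ball' ?_))
    linarith
  have h1 := hVD x r (2 * s) hr (by linarith)
  have h2 := (hV s hs0).trans hsub
  rw [Real.mul_rpow two_pos.le hs0.le, div_le_iff₀ (by positivity)] at h1
  have h3 := h2.trans h1
  have e1 : 1 + r + dist x0 x = 1 + s := by rw [hs]; ring
  have e2 : 1 + dist x0 x / r = s / r := by rw [hs]; field_simp
  have e3 : -(β - 2 * C) = 2 * C - β := by ring
  have e4 : (s / r) ^ (-(γ - β)) = s ^ β / s ^ γ * (r ^ γ / r ^ β) := by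
    rw [Real.div_rpow hs0.le hr.le, neg_sub, Real.rpow_sub hs0, Real.rpow_sub hr]
    field_simp
  rw [e1, e2, e3, e4, ge_iff_le]
  set W := (m (ball x r)).toReal
  have hrβ : 0 < r ^ β := by positivity
  have hrγ : 0 < r ^ γ := by positivity
  have hsγ : 0 < s ^ γ := by positivity
  have h2γ : (0 : ℝ) < 2 ^ γ := by positivity
  calc _ = (c * s ^ β * (1 + s) ^ (2 * C - β)) * (r ^ γ / (D * 2 ^ γ * s ^ γ)) / r ^ β := by
        field_simp
    _ ≤ (D * (W / r ^ γ) * (2 ^ γ * s ^ γ)) * (r ^ γ / (D * 2 ^ γ * s ^ γ)) / r ^ β := by gcongr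
    _ = W / r ^ β := by field_simp
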